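/- Let (x, z) and (x′, z′) be solutions of the traffic flow model with the same routing matrix R, the same travel times δ, and the same capacity function c, but with external inflows λ and λ′, where λ, λ′, c are locally piecewise constant, λ_i(t) ≤ λ′_i(t) for all i ∈ E and t ≥ 0, the initial conditions satisfy x_i(0) ≤ x′_i(0) for all i ∈ E, and the initial histories are piecewise constant with z_j(s) ≤ z′_j(s) for all j ∈ E and s ∈ [−δ̄, 0). Then x_i(t) ≤ x′_i(t) and z_i(t) ≤ z′_i(t) for all i ∈ E and all t ≥ 0. -/

import Mathlib

open MeasureTheory

variable {E : Type*}

/-- `f` is piecewise constant on the set `s`: there is a finite set `D` of breakpoints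
such that `f` is constant between consecutive breakpoints (pieces are right-open). -/
def PwcOn (f : ℝ → ℝ) (s : Set ℝ) : Prop :=
  ∃ D : Finset ℝ, ∀ u ∈ s, ∀ v ∈ s, u ≤ v → (∀ d ∈ D, d ∉ Set.Ioc u v) → f u = f v

/-- `f` is locally piecewise constant on `s`: piecewise constant on every compact
subinterval of `s`. -/
def LocPwcOn (f : ℝ → ℝ) (s : Set ℝ) : Prop :=
  ∀ a b : ℝ, PwcOn f (s ∩ Set.Icc a b)

/-- The maximum `δ̄` of the inter-link travel times over pairs `(j, i)` with `R j i > 0`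
(and `0` if there are no such pairs). -/
noncomputable def dbar (R δ : E → E → ℝ) : ℝ :=
  sSup (insert 0 {d : ℝ | ∃ j i, 0 < R j i ∧ δ j i = d})

/-- `w ∈ ℝ^E` is feasible at time `t` for the traffic flow model:
`w i ≤ c t i` for every link `i`, and for every link `i` with empty queue (`x t i = 0`),
`w i ≤ λ̃_i(t) + Σ_{j ∈ E_i} R j i * w j`, where `E_i = {j : R j i > 0 ∧ δ j i = 0}` and
`λ̃_i(t) = λ_i(t) + Σ_{j ∉ E_i} R j i * z (t - δ j i) j`. -/
def FeasibleAt (R δ : E → E → ℝ) (lam c : ℝ → E → ℝ) (x z : ℝ → E → ℝ)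
    (t : ℝ) (w : E → ℝ) [Fintype E] : Prop :=
  (∀ i, w i ≤ c t i) ∧
  ∀ i, x t i = 0 →
    w i ≤ lam t i + ∑ j, R j i * (if δ j i = 0 then w j else z (t - δ j i) j)

/-- `(x, z)` is a solution of the traffic flow model with routing matrix `R`, travel
times `δ`, external inflow `lam` and capacity `c`: queue lengths and outflows are
nonnegative, `z` is locally integrable on `[-δ̄, ∞)`, at every time `t ≥ 0` the outflow
`z t` is feasible and maximizes the cumulative outflow `Σ_i w i` among feasible vectors,
and the queue lengths satisfy the integral mass-balance equation. -/
def IsSolution [Fintype E] (R δ : E → E → ℝ) (lam c : ℝ → E → ℝ)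
    (x z : ℝ → E → ℝ) : Prop :=
  (∀ t, 0 ≤ t → ∀ i, 0 ≤ x t i) ∧
  (∀ t, -(dbar R δ) ≤ t → ∀ i, 0 ≤ z t i) ∧
  (∀ i, LocallyIntegrableOn (fun t => z t i) (Set.Ici (-(dbar R δ)))) ∧
  (∀ t, 0 ≤ t → FeasibleAt R δ lam c x z t (fun i => z t i)) ∧
  (∀ t, 0 ≤ t → ∀ w : E → ℝ, FeasibleAt R δ lam c x z t w → ∑ i, w i ≤ ∑ i, z t i) ∧
  (∀ t, 0 ≤ t → ∀ i,
    x t i = x 0 i + ∫ s in (0:ℝ)..t, (lam s i + ∑ j, R j i * z (s - δ j i) j - z s i))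

/-- Reachability in the directed graph on links with an edge from `j` to `i`
whenever `R j i > 0`. -/
def Reach (R : E → E → ℝ) : E → E → Prop :=
  Relation.TransGen fun a b => 0 < R a b

/-- Connectivity assumption: the graph is weakly connected, all row sums of `R` are at
most one, and from every link either its own row sum is less than one or a link with
row sum less than one is reachable. -/
def ConnAssumption [Fintype E] (R : E → E → ℝ) : Prop :=
  (∀ i j : E, i ≠ j → Reach R i j ∨ Reach R j i) ∧
  (∀ i : E, ∑ l, R i l ≤ 1) ∧
  (∀ i : E, (∑ l, R i l < 1) ∨ ∃ j, Reach R i j ∧ ∑ l, R j l < 1)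

/-- Stability condition: `c̄_i − Σ_j R j i * c̄_j > λ̄_i` for every link `i`, where bars
denote averages over one period `[0, T]`. -/
def Stability [Fintype E] (T : ℝ) (R : E → E → ℝ) (lam c : ℝ → E → ℝ) : Prop :=
  ∀ i : E, (1 / T) * ∫ s in (0:ℝ)..T, lam s i <
    (1 / T) * (∫ s in (0:ℝ)..T, c s i) -
      ∑ j, R j i * ((1 / T) * ∫ s in (0:ℝ)..T, c s j)

section Helpers

open Set Filter Topology

theorem PwcOn.eventually_eq {f : ℝ → ℝ} {S : Set ℝ} (hf : PwcOn f S) {τ : ℝ}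
    (hS : ∀ᶠ s in 𝓝[≥] τ, s ∈ S) : ∀ᶠ s in 𝓝[≥] τ, f s = f τ := by
  obtain ⟨D, hD⟩ := hf
  have hbreak : ∀ᶠ s in 𝓝[≥] τ, ∀ d ∈ D, d ∉ Ioc τ s := by
    rw [Finset.eventually_all]
    intro d _
    rcases le_or_gt d τ with h | h
    · exact Eventually.of_forall fun s hs => absurd hs.1 (not_lt.2 h)
    · filter_upwards [mem_nhdsWithin_of_mem_nhds (Iio_mem_nhds h)] with s hs hds
      exact absurd hds.2 (not_le.2 hs)
  filter_upwards [hS, hbreak, self_mem_nhdsWithin] with s h1 h2 h3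
  exact (hD τ (hS.self_of_nhdsWithin self_mem_Ici) s h1 h3 h2).symm

theorem LocPwcOn.eventually_eq {f : ℝ → ℝ} (hf : LocPwcOn f (Ici 0)) {τ : ℝ} (hτ : 0 ≤ τ) :
    ∀ᶠ s in 𝓝[≥] τ, f s = f τ := by
  refine (hf τ (τ + 1)).eventually_eq ?_
  filter_upwards [Icc_mem_nhdsGE (show τ < τ + 1 by linarith)] with s hs
  exact ⟨hτ.trans hs.1, hs⟩

/-- A piecewise constant function is integrable on bounded measurable sets. -/
theorem PwcOn.integrableOn {f : ℝ → ℝ} {S : Set ℝ} (hf : PwcOn f S) (hS : MeasurableSet S)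
    (hfin : volume S ≠ ⊤) : IntegrableOn f S := by
  classical
  obtain ⟨D, hD⟩ := hf
  let g : ℝ → ℕ := fun u => (D.filter (· ≤ u)).card
  have hg : Monotone g := fun u v huv =>
    Finset.card_le_card fun d hd => by
      rw [Finset.mem_filter] at hd ⊢
      exact ⟨hd.1, hd.2.trans huv⟩
  have hgle : ∀ u, g u ≤ D.card := fun u => Finset.card_filter_le _ _
  have key : ∀ u ∈ S, ∀ v ∈ S, u ≤ v → g u = g v → f u = f v := by
    intro u hu v hv huv heq
    refine hD u hu v hv huv fun d hd hdu => ?_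
    have hsub : D.filter (· ≤ u) ⊆ D.filter (· ≤ v) := fun e he => by
      rw [Finset.mem_filter] at he ⊢
      exact ⟨he.1, he.2.trans huv⟩
    have hset := Finset.eq_of_subset_of_card_le hsub heq.symm.le
    have hmem : d ∈ D.filter (· ≤ u) := by
      rw [hset, Finset.mem_filter]
      exact ⟨hd, hdu.2⟩
    exact absurd hdu.1 (not_lt.2 (Finset.mem_filter.1 hmem).2)
  let F : ℕ → ℝ := fun n => if h : ∃ u ∈ S, g u = n then f h.choose else 0
  have hF : ∀ u ∈ S, F (g u) = f u := by
    intro u hu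
    have h : ∃ v ∈ S, g v = g u := ⟨u, hu, rfl⟩
    have h1 := h.choose_spec
    simp only [F, dif_pos h]
    rcases le_total h.choose u with hle | hle
    · exact key _ h1.1 _ hu hle h1.2
    · exact (key _ hu _ h1.1 hle h1.2.symm).symm
  have hmeas : Measurable (F ∘ g) := (measurable_of_countable F).comp hg.measurable
  have hint : IntegrableOn (F ∘ g) S := by
    refine IntegrableOn.of_bound hfin.lt_top hmeas.aestronglyMeasurable
      (∑ n ∈ Finset.range (D.card + 1), ‖F n‖) (Eventually.of_forall fun u => ?_)
    exact Finset.single_le_sum (f := fun n => ‖F n‖) (fun n _ => norm_nonneg _)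
      (Finset.mem_range.2 (Nat.lt_succ_of_le (hgle u)))
  exact hint.congr_fun hF hS

theorem LocPwcOn.intervalIntegrable {f : ℝ → ℝ} (hf : LocPwcOn f (Ici 0)) {a b : ℝ}
    (ha : 0 ≤ a) (hab : a ≤ b) : IntervalIntegrable f volume a b := by
  rw [intervalIntegrable_iff_integrableOn_Icc_of_le hab]
  have hsub : Icc a b ⊆ Ici 0 := fun s hs => ha.trans hs.1
  have h := hf a b
  rw [inter_eq_self_of_subset_right hsub] at h
  exact h.integrableOn measurableSet_Icc (by simp)

theorem dbar_nonneg [Finite E] (R δ : E → E → ℝ) : 0 ≤ dbar R δ := by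
  refine le_csSup ?_ (mem_insert _ _)
  refine ((Set.finite_range fun p : E × E => δ p.1 p.2).insert 0).bddAbove.mono ?_
  refine insert_subset_insert ?_
  rintro d ⟨j, i, -, rfl⟩
  exact ⟨(j, i), rfl⟩

theorem le_dbar [Finite E] {R δ : E → E → ℝ} {j i : E} (h : 0 < R j i) : δ j i ≤ dbar R δ := by
  refine le_csSup ?_ (mem_insert_of_mem _ ⟨j, i, h, rfl⟩)
  refine ((Set.finite_range fun p : E × E => δ p.1 p.2).insert 0).bddAbove.mono ?_
  refine insert_subset_insert ?_
  rintro d ⟨j, i, -, rfl⟩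
  exact ⟨(j, i), rfl⟩

/-- The total inflow into link `i` at time `t` when the links joined to it without delay have
outflow `w`. -/
noncomputable def inflow [Fintype E] (R δ : E → E → ℝ) (lam z : ℝ → E → ℝ) (t : ℝ) (w : E → ℝ)
    (i : E) : ℝ :=
  lam t i + ∑ j, R j i * (if δ j i = 0 then w j else z (t - δ j i) j)

theorem inflow_mono [Fintype E] {R δ : E → E → ℝ} {lam lam' z z' : ℝ → E → ℝ} {t : ℝ}
    {w w' : E → ℝ} {i : E} (hR : ∀ j i, 0 ≤ R j i) (hlam : lam t i ≤ lam' t i)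
    (hz : ∀ j, 0 < R j i → δ j i ≠ 0 → z (t - δ j i) j ≤ z' (t - δ j i) j)
    (hw : ∀ j, w j ≤ w' j) :
    inflow R δ lam z t w i ≤ inflow R δ lam' z' t w' i := by
  refine add_le_add hlam (Finset.sum_le_sum fun j _ => ?_)
  rcases (hR j i).eq_or_lt with h0 | hpos
  · simp [← h0]
  · refine mul_le_mul_of_nonneg_left ?_ hpos.le
    split_ifs with h
    · exact hw j
    · exact hz j hpos h

variable [Fintype E] {R δ : E → E → ℝ} {lam c x z : ℝ → E → ℝ}

/-- The outflow of a solution is the greatest feasible vector. -/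
theorem IsSolution.le_outflow (hsol : IsSolution R δ lam c x z) (hR : ∀ j i, 0 ≤ R j i)
    {t : ℝ} (ht : 0 ≤ t) {w : E → ℝ} (hw1 : ∀ i, w i ≤ c t i)
    (hw2 : ∀ i, x t i = 0 → w i ≤ inflow R δ lam z t w i) (i : E) : w i ≤ z t i := by
  obtain ⟨-, -, -, hfeas, hmax, -⟩ := hsol
  obtain ⟨hz1, hz2⟩ := hfeas t ht
  have hle : ∑ k, max (w k) (z t k) ≤ ∑ k, z t k := by
    refine hmax t ht (fun k => max (w k) (z t k)) ⟨fun k => max_le (hw1 k) (hz1 k), ?_⟩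
    intro k hk
    refine max_le ((hw2 k hk).trans ?_) (LE.le.trans (hz2 k hk) ?_)
    · exact inflow_mono hR le_rfl (fun _ _ _ => le_rfl) fun j => le_max_left _ _
    · exact inflow_mono (w := fun i => z t i) (w' := fun k => max (w k) (z t k)) hR le_rfl
        (fun _ _ _ => le_rfl) fun j => le_max_right _ _
  have heq := (Finset.sum_eq_sum_iff_of_le (s := Finset.univ)
    (f := fun k => z t k) (g := fun k => max (w k) (z t k))
    fun k _ => le_max_right _ _).1
    (le_antisymm (Finset.sum_le_sum fun k _ => le_max_right _ _) hle) i (Finset.mem_univ i)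
  exact (le_max_left _ _).trans heq.ge

theorem IsSolution.outflow_le_capacity (hsol : IsSolution R δ lam c x z) {t : ℝ} (ht : 0 ≤ t)
    (i : E) : z t i ≤ c t i := (hsol.2.2.2.1 t ht).1 i

theorem IsSolution.outflow_le_inflow (hsol : IsSolution R δ lam c x z) {t : ℝ} (ht : 0 ≤ t)
    {i : E} (hi : x t i = 0) : z t i ≤ inflow R δ lam z t (z t) i :=
  (hsol.2.2.2.1 t ht).2 i hi

/-- If the outflow of a link can be raised without violating its own constraint, the link
operates at capacity. -/
theorem IsSolution.outflow_eq_capacity (hsol : IsSolution R δ lam c x z)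
    (hR : ∀ j i, 0 ≤ R j i) {t : ℝ} (ht : 0 ≤ t) {i : E}
    (hi : x t i = 0 → z t i < inflow R δ lam z t (z t) i) : z t i = c t i := by
  classical
  refine le_antisymm (hsol.outflow_le_capacity ht i) ?_
  by_contra! hlt
  let a := if x t i = 0 then min (c t i) (inflow R δ lam z t (z t) i) else c t i
  have hza : z t i < a := by
    simp only [a]
    split_ifs with h
    · exact lt_min hlt (hi h)
    · exact hlt
  have hac : a ≤ c t i := by
    simp only [a]
    split_ifs with h
    · exact min_le_left _ _
    · exact le_rfl
  have hmono : ∀ k, z t k ≤ Function.update (z t) i a k := fun k => by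
    rcases eq_or_ne k i with rfl | hk
    · simpa using hza.le
    · simp [hk]
  have h := hsol.le_outflow hR ht (w := Function.update (z t) i a) ?_ ?_ i
  · rw [Function.update_self] at h
    exact absurd hza (not_lt.2 h)
  · intro k
    rcases eq_or_ne k i with rfl | hk
    · simpa using hac
    · simpa [hk] using hsol.outflow_le_capacity ht k
  · intro k hk0
    refine le_trans ?_ (inflow_mono hR le_rfl (fun _ _ _ => le_rfl) hmono)
    rcases eq_or_ne k i with rfl | hk
    · simp [a, hk0]
    · simpa [hk] using hsol.outflow_le_inflow ht hk0

theorem IsSolution.intervalIntegrable_outflow (hsol : IsSolution R δ lam c x z) {a b : ℝ}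
    (ha : -(dbar R δ) ≤ a) (hab : a ≤ b) (i : E) :
    IntervalIntegrable (fun s => z s i) volume a b := by
  rw [intervalIntegrable_iff_integrableOn_Icc_of_le hab]
  exact (hsol.2.2.1 i).integrableOn_compact_subset (fun s hs => ha.trans hs.1) isCompact_Icc

theorem IsSolution.intervalIntegrable_routed (hsol : IsSolution R δ lam c x z)
    (hR : ∀ j i, 0 ≤ R j i) {a b : ℝ} (ha : 0 ≤ a) (hab : a ≤ b) (j i : E) :
    IntervalIntegrable (fun s => R j i * z (s - δ j i) j) volume a b := by
  rcases (hR j i).eq_or_lt with h0 | hpos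
  · simp [← h0]
  · have hd := le_dbar (δ := δ) hpos
    have h := hsol.intervalIntegrable_outflow (a := a - δ j i) (b := b - δ j i)
      (by linarith) (by linarith) j
    simpa using (h.comp_sub_right (δ j i)).const_mul (R j i)

theorem IsSolution.intervalIntegrable_sum_routed (hsol : IsSolution R δ lam c x z)
    (hR : ∀ j i, 0 ≤ R j i) {a b : ℝ} (ha : 0 ≤ a) (hab : a ≤ b) (i : E) :
    IntervalIntegrable (fun s => ∑ j, R j i * z (s - δ j i) j) volume a b := by
  have h := IntervalIntegrable.sum Finset.univ
    (fun j _ => hsol.intervalIntegrable_routed hR ha hab j i)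
  have heq : (fun s => ∑ j, R j i * z (s - δ j i) j) =
      ∑ j, fun s => R j i * z (s - δ j i) j := by
    ext s
    simp
  rwa [heq]

theorem IsSolution.intervalIntegrable_netflow (hsol : IsSolution R δ lam c x z)
    (hR : ∀ j i, 0 ≤ R j i) (hlam : ∀ i, LocPwcOn (fun t => lam t i) (Ici 0)) {a b : ℝ}
    (ha : 0 ≤ a) (hab : a ≤ b) (i : E) :
    IntervalIntegrable (fun s => lam s i + ∑ j, R j i * z (s - δ j i) j - z s i) volume a b := by
  have hd := dbar_nonneg R δ
  exact (((hlam i).intervalIntegrable ha hab).add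
    (hsol.intervalIntegrable_sum_routed hR ha hab i)).sub
    (hsol.intervalIntegrable_outflow (by linarith) hab i)

theorem IsSolution.queue_eq (hsol : IsSolution R δ lam c x z) (hR : ∀ j i, 0 ≤ R j i)
    (hlam : ∀ i, LocPwcOn (fun t => lam t i) (Ici 0)) {a b : ℝ} (ha : 0 ≤ a) (hab : a ≤ b)
    (i : E) :
    x b i = x a i + ∫ s in a..b, (lam s i + ∑ j, R j i * z (s - δ j i) j - z s i) := by
  rw [hsol.2.2.2.2.2 b (ha.trans hab) i, hsol.2.2.2.2.2 a ha i, add_assoc,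
    intervalIntegral.integral_add_adjacent_intervals
      (hsol.intervalIntegrable_netflow hR hlam le_rfl ha i)
      (hsol.intervalIntegrable_netflow hR hlam ha hab i)]

theorem IsSolution.continuousOn_queue (hsol : IsSolution R δ lam c x z)
    (hR : ∀ j i, 0 ≤ R j i) (hlam : ∀ i, LocPwcOn (fun t => lam t i) (Ici 0)) (i : E) :
    ContinuousOn (fun t => x t i) (Ici 0) := by
  intro t ht
  have ht1 : (0:ℝ) ≤ t + 1 := by linarith [mem_Ici.1 ht]
  have hint := hsol.intervalIntegrable_netflow hR hlam le_rfl ht1 i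
  have hcont := intervalIntegral.continuousOn_primitive_interval'
    hint (left_mem_uIcc)
  rw [uIcc_of_le ht1] at hcont
  have hcont' : ContinuousOn (fun t => x t i) (Icc 0 (t + 1)) :=
    (continuousOn_const.add hcont).congr fun s hs => hsol.2.2.2.2.2 s hs.1 i
  refine (hcont' t ⟨ht, by linarith⟩).mono_of_mem_nhdsWithin ?_
  filter_upwards [self_mem_nhdsWithin, mem_nhdsWithin_of_mem_nhds
    (Iio_mem_nhds (show t < t + 1 by linarith))] with s h1 h2
  exact ⟨h1, le_of_lt h2⟩

/-- If the inflows, capacities and delayed outflows are constant just after `τ`, then so is the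
outflow, and the queues evolve linearly. -/
theorem IsSolution.eventually_const (hsol : IsSolution R δ lam c x z) (hR : ∀ j i, 0 ≤ R j i)
    (hlam : ∀ i, LocPwcOn (fun t => lam t i) (Ici 0))
    (hc : ∀ i, LocPwcOn (fun t => c t i) (Ici 0)) {τ : ℝ} (hτ : 0 ≤ τ)
    (hdel : ∀ j i, 0 < R j i → δ j i ≠ 0 → ∀ᶠ s in 𝓝[≥] (τ - δ j i), z s j = z (τ - δ j i) j) :
    ∀ᶠ s in 𝓝[≥] τ, ∀ i, z s i = z τ i ∧
      x s i = x τ i + (s - τ) * (inflow R δ lam z τ (z τ) i - z τ i) := by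
  have hdel' : ∀ᶠ s in 𝓝[≥] τ, ∀ j i, 0 < R j i → δ j i ≠ 0 →
      z (s - δ j i) j = z (τ - δ j i) j := by
    simp only [eventually_all]
    intro j i h1 h2
    have htend : Tendsto (fun s => s - δ j i) (𝓝[≥] τ) (𝓝[≥] (τ - δ j i)) := by
      refine tendsto_nhdsWithin_iff.2 ⟨?_, ?_⟩
      · exact ((continuous_id.sub continuous_const).tendsto τ).mono_left nhdsWithin_le_nhds
      · filter_upwards [self_mem_nhdsWithin] with s hs
        exact sub_le_sub_right (mem_Ici.1 hs) _
    exact htend.eventually (hdel j i h1 h2)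
  have hlam' : ∀ᶠ s in 𝓝[≥] τ, ∀ i, lam s i = lam τ i :=
    eventually_all.2 fun i => (hlam i).eventually_eq hτ
  have hc' : ∀ᶠ s in 𝓝[≥] τ, ∀ i, c s i = c τ i :=
    eventually_all.2 fun i => (hc i).eventually_eq hτ
  have hpos : ∀ᶠ s in 𝓝[≥] τ, ∀ i, 0 < x τ i → 0 < x s i := by
    simp only [eventually_all]
    intro i hi
    have hcw : ContinuousWithinAt (fun t => x t i) (Ici τ) τ :=
      (hsol.continuousOn_queue hR hlam i τ hτ).mono (Ici_subset_Ici.2 hτ)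
    exact hcw.eventually (lt_mem_nhds hi)
  obtain ⟨T, hT, hsub⟩ := mem_nhdsGE_iff_exists_Ico_subset.1
    (((hdel'.and hlam').and hc').and hpos)
  have hinfl : ∀ s ∈ Ico τ T, ∀ w i, inflow R δ lam z s w i = inflow R δ lam z τ w i := by
    intro s hs w i
    obtain ⟨⟨⟨h1, h2⟩, -⟩, -⟩ := hsub hs
    unfold inflow
    rw [h2 i]
    congr 1
    refine Finset.sum_congr rfl fun j _ => ?_
    rcases (hR j i).eq_or_lt with h0 | hp
    · simp [← h0]
    · split_ifs with h
      · rfl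
      · rw [h1 j i hp h]
  have hzero : ∀ s ∈ Ico τ T, ∀ i, x s i = 0 → x τ i = 0 := by
    intro s hs i h
    by_contra hne
    exact ((hsub hs).2 i (lt_of_le_of_ne (hsol.1 τ hτ i) (Ne.symm hne))).ne' h
  have hge : ∀ s ∈ Ico τ T, ∀ i, z τ i ≤ z s i := by
    intro s hs i
    refine hsol.le_outflow hR (hτ.trans hs.1) (fun k => ?_) (fun k hk => ?_) i
    · rw [(hsub hs).1.2 k]
      exact hsol.outflow_le_capacity hτ k
    · rw [hinfl s hs]
      exact hsol.outflow_le_inflow hτ (hzero s hs k hk)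
  have hd0 := dbar_nonneg R δ
  have hlin : ∀ s ∈ Ioo τ T, ∀ i,
      x s i = x τ i + (s - τ) * (inflow R δ lam z τ (z τ) i - z τ i) := by
    intro s hs
    have hlen : 0 < s - τ := sub_pos.2 hs.1
    have hzint := fun j => hsol.intervalIntegrable_outflow (show -(dbar R δ) ≤ τ by linarith)
      hs.1.le j
    let m : E → ℝ := fun j => (s - τ)⁻¹ * ∫ r in τ..s, z r j
    have hm : ∀ j, ∫ r in τ..s, z r j = (s - τ) * m j := fun j => by
      simp only [m]
      field_simp
    have hx : ∀ i, x s i = x τ i + (s - τ) * (inflow R δ lam z τ m i - m i) := by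
      intro i
      have hterm : ∀ j, ∫ r in τ..s, R j i * z (r - δ j i) j =
          (s - τ) * (R j i * (if δ j i = 0 then m j else z (τ - δ j i) j)) := by
        intro j
        rcases (hR j i).eq_or_lt with h0 | hp
        · simp [← h0]
        · rw [intervalIntegral.integral_const_mul]
          split_ifs with h
          · simp only [h, sub_zero, hm]
            ring
          · have hcongr : ∫ r in τ..s, z (r - δ j i) j = ∫ _ in τ..s, z (τ - δ j i) j := by
              refine intervalIntegral.integral_congr fun r hr => ?_
              rw [uIcc_of_le hs.1.le] at hr
              exact (hsub ⟨hr.1, hr.2.trans_lt hs.2⟩).1.1.1 j i hp h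
            rw [hcongr, intervalIntegral.integral_const, smul_eq_mul]
            ring
      have hlamint : ∫ r in τ..s, lam r i = (s - τ) * lam τ i := by
        have hcongr : ∫ r in τ..s, lam r i = ∫ _ in τ..s, lam τ i := by
          refine intervalIntegral.integral_congr fun r hr => ?_
          rw [uIcc_of_le hs.1.le] at hr
          exact (hsub ⟨hr.1, hr.2.trans_lt hs.2⟩).1.1.2 i
        rw [hcongr, intervalIntegral.integral_const, smul_eq_mul]
      have hrint := fun j => hsol.intervalIntegrable_routed hR hτ hs.1.le j i
      have hsumint := hsol.intervalIntegrable_sum_routed hR hτ hs.1.le i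
      have hli := (hlam i).intervalIntegrable hτ hs.1.le
      rw [hsol.queue_eq hR hlam hτ hs.1.le i,
        intervalIntegral.integral_sub (hli.add hsumint) (hzint i),
        intervalIntegral.integral_add hli hsumint,
        intervalIntegral.integral_finsetSum fun j _ => hrint j, hlamint, hm]
      simp only [hterm, ← Finset.mul_sum, inflow]
      ring
    have hmle : ∀ j, m j ≤ z τ j := by
      refine hsol.le_outflow hR hτ (fun j => ?_) (fun i hi => ?_)
      · have h : ∫ r in τ..s, z r j ≤ ∫ _ in τ..s, c τ j := by
          refine intervalIntegral.integral_mono_on hs.1.le (hzint j)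
            intervalIntegrable_const fun r hr => ?_
          rw [← (hsub ⟨hr.1, hr.2.trans_lt hs.2⟩).1.2 j]
          exact hsol.outflow_le_capacity (hτ.trans hr.1) j
        rw [hm, intervalIntegral.integral_const, smul_eq_mul] at h
        exact le_of_mul_le_mul_left h hlen
      · have h := hsol.1 s (hτ.trans hs.1.le) i
        rw [hx i, hi, zero_add] at h
        exact sub_nonneg.1 (nonneg_of_mul_nonneg_right h hlen)
    have hmge : ∀ j, z τ j ≤ m j := by
      intro j
      have h : ∫ _ in τ..s, z τ j ≤ ∫ r in τ..s, z r j := by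
        refine intervalIntegral.integral_mono_on hs.1.le
          intervalIntegrable_const (hzint j) fun r hr => ?_
        exact hge r ⟨hr.1, hr.2.trans_lt hs.2⟩ j
      rw [hm, intervalIntegral.integral_const, smul_eq_mul] at h
      exact le_of_mul_le_mul_left h hlen
    have hmeq : m = z τ := funext fun j => le_antisymm (hmle j) (hmge j)
    rwa [hmeq] at hx
  filter_upwards [Ico_mem_nhdsGE hT] with s hs i
  rcases hs.1.eq_or_lt with rfl | hlt
  · simp
  refine ⟨le_antisymm ?_ (hge s hs i), hlin s ⟨hlt, hs.2⟩ i⟩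
  refine hsol.le_outflow hR hτ (fun k => ?_) (fun k hk => ?_) i
  · rw [← (hsub hs).1.2 k]
    exact hsol.outflow_le_capacity (hτ.trans hs.1) k
  · by_cases hks : x s k = 0
    · rw [← hinfl s hs]
      exact hsol.outflow_le_inflow (hτ.trans hs.1) hks
    · have h := hlin s ⟨hlt, hs.2⟩ k
      rw [hk, zero_add] at h
      have hslack : z τ k < inflow R δ lam z τ (z τ) k := by
        have hp : 0 < x s k :=
          lt_of_le_of_ne (hsol.1 s (hτ.trans hs.1) k) (Ne.symm hks)
        rw [h] at hp
        exact sub_pos.1 (pos_of_mul_pos_right hp (sub_nonneg.2 hs.1))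
      calc z s k ≤ c s k := hsol.outflow_le_capacity (hτ.trans hs.1) k
        _ = c τ k := (hsub hs).1.2 k
        _ = z τ k := (hsol.outflow_eq_capacity hR hτ fun _ => hslack).symm
        _ ≤ inflow R δ lam z τ (z τ) k := hslack.le
        _ ≤ inflow R δ lam z τ (z s) k :=
          inflow_mono hR le_rfl (fun _ _ _ => le_rfl) (hge s hs)

/-- The outflow of a solution with piecewise constant data is constant to the right of each
time. -/
theorem IsSolution.eventually_outflow_eq (hsol : IsSolution R δ lam c x z)
    (hR : ∀ j i, 0 ≤ R j i) (hδ : ∀ j i, 0 ≤ δ j i)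
    (hlam : ∀ i, LocPwcOn (fun t => lam t i) (Ici 0))
    (hc : ∀ i, LocPwcOn (fun t => c t i) (Ici 0))
    (hhist : ∀ i, PwcOn (fun t => z t i) (Ico (-(dbar R δ)) 0)) {τ : ℝ}
    (hτ : -(dbar R δ) ≤ τ) (i : E) : ∀ᶠ s in 𝓝[≥] τ, z s i = z τ i := by
  obtain ⟨ε, hε, hεle⟩ : ∃ ε > 0, ∀ j i, δ j i ≠ 0 → ε ≤ δ j i := by
    have h : ∀ᶠ ε in 𝓝[>] (0:ℝ), ∀ j i, δ j i ≠ 0 → ε ≤ δ j i := by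
      simp only [eventually_all]
      intro j i hne
      have hp : 0 < δ j i := lt_of_le_of_ne (hδ j i) (Ne.symm hne)
      filter_upwards [Ioo_mem_nhdsGT hp] with ε hε
      exact hε.2.le
    obtain ⟨ε, h1, h2⟩ := (h.and self_mem_nhdsWithin).exists
    exact ⟨ε, h2, h1⟩
  have key : ∀ n : ℕ, ∀ τ, -(dbar R δ) ≤ τ → τ < n * ε → ∀ i,
      ∀ᶠ s in 𝓝[≥] τ, z s i = z τ i := by
    intro n
    induction n with
    | zero =>
      intro τ h1 h2 i
      rw [Nat.cast_zero, zero_mul] at h2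
      refine (hhist i).eventually_eq ?_
      filter_upwards [Ico_mem_nhdsGE h2] with s hs
      exact ⟨h1.trans hs.1, hs.2⟩
    | succ n ih =>
      intro τ h1 h2 i
      rcases lt_or_ge τ 0 with hneg | hnn
      · refine (hhist i).eventually_eq ?_
        filter_upwards [Ico_mem_nhdsGE hneg] with s hs
        exact ⟨h1.trans hs.1, hs.2⟩
      · refine (hsol.eventually_const hR hlam hc hnn fun j k hp hne => ?_).mono
          fun s hs => (hs i).1
        have hd := le_dbar (δ := δ) hp
        have hl := hεle j k hne
        push_cast at h2
        exact ih _ (by linarith) (by linarith) j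
  obtain ⟨n, hn⟩ := exists_nat_gt (τ / ε)
  exact key n τ hτ ((div_lt_iff₀ hε).1 hn) i

variable {lam' x' z' : ℝ → E → ℝ}

/-- The outflow at a given time is monotone in the queues, external inflows and past outflows. -/
theorem IsSolution.outflow_mono (hsol : IsSolution R δ lam c x z)
    (hsol' : IsSolution R δ lam' c x' z') (hR : ∀ j i, 0 ≤ R j i) {t : ℝ} (ht : 0 ≤ t)
    (hlam : ∀ i, lam t i ≤ lam' t i) (hx : ∀ i, x t i ≤ x' t i)
    (hz : ∀ j i, 0 < R j i → δ j i ≠ 0 → z (t - δ j i) j ≤ z' (t - δ j i) j) (i : E) :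
    z t i ≤ z' t i := by
  refine hsol'.le_outflow hR ht (hsol.outflow_le_capacity ht) (fun k hk => ?_) i
  have hk0 : x t k = 0 := le_antisymm (hk ▸ hx k) (hsol.1 t ht k)
  exact (hsol.outflow_le_inflow ht hk0).trans
    (inflow_mono hR (hlam k) (fun j => hz j k) fun _ => le_rfl)

/-- Ordered queues at time `t` stay ordered for a short time if they evolve linearly. -/
theorem IsSolution.eventually_queue_le (hsol : IsSolution R δ lam c x z)
    (hsol' : IsSolution R δ lam' c x' z') (hR : ∀ j i, 0 ≤ R j i) {t : ℝ} (ht : 0 ≤ t)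
    (hlam : ∀ i, lam t i ≤ lam' t i) (hx : ∀ i, x t i ≤ x' t i)
    (hz : ∀ j i, 0 < R j i → δ j i ≠ 0 → z (t - δ j i) j ≤ z' (t - δ j i) j) {i : E}
    (hlin : ∀ᶠ s in 𝓝[≥] t, x s i = x t i + (s - t) * (inflow R δ lam z t (z t) i - z t i))
    (hlin' : ∀ᶠ s in 𝓝[≥] t,
      x' s i = x' t i + (s - t) * (inflow R δ lam' z' t (z' t) i - z' t i)) :
    ∀ᶠ s in 𝓝[≥] t, x s i ≤ x' s i := by
  have hzt := hsol.outflow_mono hsol' hR ht hlam hx hz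
  have hinf : inflow R δ lam z t (z t) i ≤ inflow R δ lam' z' t (z' t) i :=
    inflow_mono hR (hlam i) (fun j => hz j i) hzt
  rcases (hx i).eq_or_lt with heq | hlt
  · have hdrift : inflow R δ lam z t (z t) i - z t i ≤
        inflow R δ lam' z' t (z' t) i - z' t i := by
      by_cases hslack : x t i = 0 → z t i < inflow R δ lam z t (z t) i
      · have h1 := hsol.outflow_eq_capacity hR ht hslack
        have h2 := hsol'.outflow_le_capacity ht i
        linarith
      · push Not at hslack
        have h1 := hsol'.outflow_le_inflow ht (heq ▸ hslack.1)
        linarith [hslack.2]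
    filter_upwards [hlin, hlin', self_mem_nhdsWithin] with s h1 h2 h3
    rw [h1, h2, heq]
    have := mul_le_mul_of_nonneg_left hdrift (sub_nonneg.2 (mem_Ici.1 h3))
    linarith
  · have hcont : Continuous fun s =>
        (x' t i + (s - t) * (inflow R δ lam' z' t (z' t) i - z' t i)) -
          (x t i + (s - t) * (inflow R δ lam z t (z t) i - z t i)) := by
      fun_prop
    have hpos := (hcont.tendsto t).eventually (lt_mem_nhds (a := 0) (by simpa using hlt))
    filter_upwards [hlin, hlin', mem_nhdsWithin_of_mem_nhds hpos] with s h1 h2 h3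
    rw [h1, h2]
    exact (sub_pos.1 h3).le

end Helpers

/-- Monotonicity: if two solutions of the traffic flow model share `R`, `δ`, `c`, and the
external inflows, initial conditions and initial histories are ordered, then the queue
lengths and outflows remain ordered for all times. -/
theorem traffic_flow_monotone [Fintype E] [Nonempty E]
    (R δ : E → E → ℝ) (lam lam' c : ℝ → E → ℝ) (x z x' z' : ℝ → E → ℝ)
    (hRnn : ∀ j i, 0 ≤ R j i) (hδnn : ∀ j i, 0 ≤ δ j i)
    (hlam_nn : ∀ t, 0 ≤ t → ∀ i, 0 ≤ lam t i)
    (hlam'_nn : ∀ t, 0 ≤ t → ∀ i, 0 ≤ lam' t i)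
    (hc_nn : ∀ t, 0 ≤ t → ∀ i, 0 ≤ c t i)
    (hlam_pwc : ∀ i, LocPwcOn (fun t => lam t i) (Set.Ici 0))
    (hlam'_pwc : ∀ i, LocPwcOn (fun t => lam' t i) (Set.Ici 0))
    (hc_pwc : ∀ i, LocPwcOn (fun t => c t i) (Set.Ici 0))
    (hsol : IsSolution R δ lam c x z) (hsol' : IsSolution R δ lam' c x' z')
    (hlam_le : ∀ t, 0 ≤ t → ∀ i, lam t i ≤ lam' t i)
    (hx0 : ∀ i, x 0 i ≤ x' 0 i)
    (hz_hist_pwc : ∀ i, PwcOn (fun t => z t i) (Set.Ico (-(dbar R δ)) 0))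
    (hz'_hist_pwc : ∀ i, PwcOn (fun t => z' t i) (Set.Ico (-(dbar R δ)) 0))
    (hz_hist_le : ∀ s ∈ Set.Ico (-(dbar R δ)) 0, ∀ j, z s j ≤ z' s j) :
    ∀ t, 0 ≤ t → ∀ i, x t i ≤ x' t i ∧ z t i ≤ z' t i := by
  have hrc := fun {τ : ℝ} (hτ : -(dbar R δ) ≤ τ) =>
    hsol.eventually_outflow_eq hRnn hδnn hlam_pwc hc_pwc hz_hist_pwc hτ
  have hrc' := fun {τ : ℝ} (hτ : -(dbar R δ) ≤ τ) =>
    hsol'.eventually_outflow_eq hRnn hδnn hlam'_pwc hc_pwc hz'_hist_pwc hτ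
  by_contra! hcon
  obtain ⟨t₁, ht₁, hbad₁⟩ := hcon
  let B : Set ℝ := {t | 0 ≤ t ∧ ¬ ∀ i, x t i ≤ x' t i ∧ z t i ≤ z' t i}
  have hBne : B.Nonempty := ⟨t₁, ht₁, by
    obtain ⟨i, hi⟩ := hbad₁
    exact fun h => absurd (h i).2 (not_le.2 (hi (h i).1))⟩
  have hBbdd : BddBelow B := ⟨0, fun t ht => ht.1⟩
  set τ := sInf B with hτdef
  have hτ : 0 ≤ τ := le_csInf hBne fun t ht => ht.1
  have hbefore : ∀ s, 0 ≤ s → s < τ → ∀ i, x s i ≤ x' s i ∧ z s i ≤ z' s i := by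
    intro s hs hsτ
    by_contra h
    exact absurd (csInf_le hBbdd (show s ∈ B from ⟨hs, h⟩)) (not_le.2 hsτ)
  have hpast : ∀ j i, 0 < R j i → δ j i ≠ 0 → z (τ - δ j i) j ≤ z' (τ - δ j i) j := by
    intro j i hp hne
    have hpos : 0 < δ j i := lt_of_le_of_ne (hδnn j i) (Ne.symm hne)
    have hd := le_dbar (δ := δ) hp
    rcases lt_or_ge (τ - δ j i) 0 with h | h
    · exact hz_hist_le _ ⟨by linarith, h⟩ j
    · exact (hbefore _ h (by linarith) j).2
  have hxτ : ∀ i, x τ i ≤ x' τ i := by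
    intro i
    rcases hτ.eq_or_lt with h0 | hpos
    · rw [← h0]
      exact hx0 i
    · have hmem : τ ∈ closure (Set.Ico 0 τ) := by
        rw [closure_Ico hpos.ne]
        exact ⟨hτ, le_rfl⟩
      exact ContinuousWithinAt.closure_le
        (f := fun t => x t i) (g := fun t => x' t i) hmem
        ((hsol.continuousOn_queue hRnn hlam_pwc i τ hτ).mono fun s hs => hs.1)
        ((hsol'.continuousOn_queue hRnn hlam'_pwc i τ hτ).mono fun s hs => hs.1)
        fun s hs => (hbefore s hs.1 hs.2 i).1
  have hd0 := dbar_nonneg R δ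
  have hzτ := hsol.outflow_mono hsol' hRnn hτ (hlam_le τ hτ) hxτ hpast
  have hlin := hsol.eventually_const hRnn hlam_pwc hc_pwc hτ fun j i hp _ =>
    hrc (by linarith [le_dbar (δ := δ) hp]) j
  have hlin' := hsol'.eventually_const hRnn hlam'_pwc hc_pwc hτ fun j i hp _ =>
    hrc' (by linarith [le_dbar (δ := δ) hp]) j
  have hxev : ∀ i, ∀ᶠ s in nhdsWithin τ (Set.Ici τ), x s i ≤ x' s i := fun i =>
    hsol.eventually_queue_le hsol' hRnn hτ (hlam_le τ hτ) hxτ hpast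
      (hlin.mono fun s hs => (hs i).2) (hlin'.mono fun s hs => (hs i).2)
  have hev : ∀ᶠ s in nhdsWithin τ (Set.Ici τ), ∀ i, x s i ≤ x' s i ∧ z s i ≤ z' s i := by
    filter_upwards [Filter.eventually_all.2 hxev, hlin, hlin'] with s h1 h2 h3 i
    refine ⟨h1 i, ?_⟩
    rw [(h2 i).1, (h3 i).1]
    exact hzτ i
  obtain ⟨T, hT, hsub⟩ := mem_nhdsGE_iff_exists_Ico_subset.1 hev
  have hle : T ≤ τ := by
    refine le_csInf hBne fun t ht => ?_
    by_contra! hlt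
    exact ht.2 (hsub ⟨csInf_le hBbdd ht, hlt⟩)
  exact absurd hT (not_lt.2 hle)
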